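/- arXiv:1612.05620 — 8 statements merged into one kernel-verified Lean document; each statement's English description precedes it below -/
import Mathlib

section
/- Let g : [a,b] → ℝ be continuous and not identically zero, let s be an integer with s ≥ 2, and let p satisfy 1 ≤ p < s. Then there exists a sequence (h_n) in C₀[a,b] with h_n ≠ 0 for all n, ‖h_n‖_p → 0, and (1/‖h_n‖_p) |∫_a^b g(x) h_n(x)^s dx| → +∞. In particular, it is false that lim_{‖h‖_p → 0} (1/‖h‖_p) ∫_a^b g(x) h(x)^s dx = 0. -/
open Set MeasureTheory intervalIntegral Filter Topology

/-- The `p`-norm (`1 ≤ p < ∞`) of `h` on `[a,b]`. -/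
noncomputable def pN (a b p : ℝ) (h : ℝ → ℝ) : ℝ :=
  (∫ x in a..b, |h x| ^ p) ^ (1 / p)

/-- `C₀[a,b]`: continuous functions on `[a,b]` vanishing at the endpoints. -/
def C0 (a b : ℝ) (h : ℝ → ℝ) : Prop := ContinuousOn h (Set.Icc a b) ∧ h a = 0 ∧ h b = 0

lemma aux_lower (a b u v k : ℝ) (hau : a ≤ u) (huv : u ≤ v) (hvb : v ≤ b) (F : ℝ → ℝ)
    (hF : ContinuousOn F (Icc a b)) (h0 : ∀ x ∈ Icc a b, 0 ≤ F x)
    (hk : ∀ x ∈ Icc u v, k ≤ F x) : (v - u) * k ≤ ∫ x in a..b, F x := by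
  have hint : ∀ y z, a ≤ y → y ≤ z → z ≤ b → IntervalIntegrable F volume y z := by
    intro y z h1 h2 h3
    apply ContinuousOn.intervalIntegrable
    rw [uIcc_of_le h2]
    exact hF.mono (Icc_subset_Icc h1 h3)
  have e1 := integral_add_adjacent_intervals (hint a u le_rfl hau (by linarith))
    (hint u b hau (by linarith) le_rfl)
  have e2 := integral_add_adjacent_intervals (hint u v hau huv hvb)
    (hint v b (by linarith) hvb le_rfl)
  have p1 : 0 ≤ ∫ x in a..u, F x := integral_nonneg hau
    (fun x hx => h0 x ⟨hx.1, by linarith [hx.2]⟩)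
  have p2 : 0 ≤ ∫ x in v..b, F x := integral_nonneg hvb
    (fun x hx => h0 x ⟨by linarith [hx.1], hx.2⟩)
  have p3 : ∫ x in u..v, k ≤ ∫ x in u..v, F x :=
    integral_mono_on huv (by simp) (hint u v hau huv hvb) hk
  simp at p3
  linarith

lemma aux_upper (a b u v k : ℝ) (hau : a ≤ u) (huv : u ≤ v) (hvb : v ≤ b) (F : ℝ → ℝ)
    (hF : ContinuousOn F (Icc a b)) (h0 : ∀ x ∈ Icc a u, F x = 0) (h1 : ∀ x ∈ Icc v b, F x = 0)
    (hk : ∀ x ∈ Icc u v, F x ≤ k) : ∫ x in a..b, F x ≤ (v - u) * k := by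
  have hint : ∀ y z, a ≤ y → y ≤ z → z ≤ b → IntervalIntegrable F volume y z := by
    intro y z h1 h2 h3
    apply ContinuousOn.intervalIntegrable
    rw [uIcc_of_le h2]
    exact hF.mono (Icc_subset_Icc h1 h3)
  have e1 := integral_add_adjacent_intervals (hint a u le_rfl hau (by linarith))
    (hint u b hau (by linarith) le_rfl)
  have e2 := integral_add_adjacent_intervals (hint u v hau huv hvb)
    (hint v b (by linarith) hvb le_rfl)
  have p1 : ∫ x in a..u, F x = ∫ x in a..u, (0:ℝ) := integral_congr
    (fun x hx => h0 x (by rwa [uIcc_of_le hau] at hx))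
  have p2 : ∫ x in v..b, F x = ∫ x in v..b, (0:ℝ) := integral_congr
    (fun x hx => h1 x (by rwa [uIcc_of_le hvb] at hx))
  have p3 : ∫ x in u..v, F x ≤ ∫ x in u..v, k :=
    integral_mono_on huv (hint u v hau huv hvb) (by simp) hk
  simp at p1 p2 p3
  linarith

lemma aux_bump (a b : ℝ) (g : ℝ → ℝ) (hg : ContinuousOn g (Set.Icc a b)) (s : ℕ) (hs : 2 ≤ s)
    (p : ℝ) (hp1 : 1 ≤ p) (c r m σ : ℝ) (hm : 0 < m) (hσ : |σ| = 1)
    (hra : a ≤ c - r) (hrb : c + r ≤ b) (hgm : ∀ x ∈ Icc (c - r) (c + r), m ≤ σ * g x)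
    (δ A : ℝ) (hδ : 0 < δ) (hδr : δ ≤ r) (hA : 0 < A) :
    ∃ h : ℝ → ℝ, C0 a b h ∧ (∃ x ∈ Icc a b, h x ≠ 0) ∧ 0 < pN a b p h ∧
      pN a b p h ≤ (2 * δ * A ^ p) ^ (1 / p) ∧
      δ * (m * (A / 2) ^ s) ≤ |∫ x in a..b, g x * h x ^ s| := by
  set h : ℝ → ℝ := fun x => A * max 0 (1 - |x - c| / δ) with hh
  have hc : Continuous h := by fun_prop
  have hn : ∀ x, 0 ≤ h x := fun x => by positivity
  have hle : ∀ x, h x ≤ A := fun x => by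
    have : max 0 (1 - |x - c| / δ) ≤ 1 := max_le (by norm_num) (by
      have : 0 ≤ |x - c| / δ := by positivity
      linarith)
    simp only [hh]
    nlinarith
  have hz : ∀ x, δ ≤ |x - c| → h x = 0 := fun x hx => by
    have : 1 ≤ |x - c| / δ := by rwa [le_div_iff₀ hδ, one_mul]
    simp only [hh]
    rw [max_eq_left (by linarith), mul_zero]
  have hlow : ∀ x ∈ Icc (c - δ/2) (c + δ/2), A / 2 ≤ h x := fun x hx => by
    have h1 : |x - c| ≤ δ / 2 := abs_le.2 ⟨by linarith [hx.1], by linarith [hx.2]⟩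
    have : |x - c| / δ ≤ 1/2 := by rw [div_le_iff₀ hδ]; linarith
    have : 1/2 ≤ max 0 (1 - |x - c| / δ) := le_max_of_le_right (by linarith)
    simp only [hh]
    nlinarith
  have hzl : ∀ x ≤ c - δ, h x = 0 := fun x hx => hz x (by
    rw [abs_of_nonpos (by linarith)]; linarith)
  have hzr : ∀ x, c + δ ≤ x → h x = 0 := fun x hx => hz x (by
    rw [abs_of_nonneg (by linarith)]; linarith)
  have hp0 : 0 < p := by linarith
  have hcp : Continuous (fun x => |h x| ^ p) := hc.abs.rpow_const (fun x => Or.inr hp0.le)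
  have I1 : δ * (A / 2) ^ p ≤ ∫ x in a..b, |h x| ^ p := by
    have := aux_lower a b (c - δ/2) (c + δ/2) ((A/2)^p) (by linarith) (by linarith) (by linarith)
      (fun x => |h x| ^ p) hcp.continuousOn (fun x _ => by positivity) (fun x hx => by
        refine Real.rpow_le_rpow (by positivity) ?_ hp0.le
        exact (hlow x hx).trans (le_abs_self _))
    convert this using 1
    ring
  have I2 : ∫ x in a..b, |h x| ^ p ≤ 2 * δ * A ^ p := by
    have := aux_upper a b (c - δ) (c + δ) (A^p) (by linarith) (by linarith) (by linarith)
      (fun x => |h x| ^ p) hcp.continuousOn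
      (fun x hx => by simp [hzl x hx.2, hp0.ne'])
      (fun x hx => by simp [hzr x hx.1, hp0.ne'])
      (fun x hx => by
        refine Real.rpow_le_rpow (by positivity) ?_ hp0.le
        rw [abs_of_nonneg (hn x)]
        exact hle x)
    convert this using 1
    ring
  have Ipos : 0 < ∫ x in a..b, |h x| ^ p := lt_of_lt_of_le (by positivity) I1
  refine ⟨h, ⟨hc.continuousOn, hzl a (by linarith), hzr b (by linarith)⟩,
    ⟨c, ⟨by linarith, by linarith⟩, ?_⟩, Real.rpow_pos_of_pos Ipos _,
    Real.rpow_le_rpow Ipos.le I2 (by positivity), ?_⟩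
  · have := hlow c ⟨by linarith, by linarith⟩
    exact (lt_of_lt_of_le (by positivity) this).ne'
  · have J := aux_lower a b (c - δ/2) (c + δ/2) (m * (A/2)^s) (by linarith) (by linarith)
      (by linarith) (fun x => σ * (g x * h x ^ s))
      (continuousOn_const.mul (hg.mul (hc.pow s).continuousOn))
      (fun x _ => by
        by_cases hx : x ∈ Icc (c - r) (c + r)
        · have := hgm x hx
          have h2 := pow_nonneg (hn x) s
          rw [← mul_assoc]
          exact mul_nonneg (by linarith) h2
        · have : h x = 0 := by
            rw [mem_Icc, not_and_or, not_le, not_le] at hx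
            rcases hx with hx | hx
            · exact hzl x (by linarith)
            · exact hzr x (by linarith)
          simp [this, show s ≠ 0 by omega])
      (fun x hx => by
        have := hgm x ⟨by linarith [hx.1], by linarith [hx.2]⟩
        have h2 : (A/2)^s ≤ h x ^ s := pow_le_pow_left₀ (by positivity) (hlow x hx) s
        rw [← mul_assoc]
        exact mul_le_mul this h2 (by positivity) (by linarith))
    rw [intervalIntegral.integral_const_mul] at J
    calc δ * (m * (A / 2) ^ s) = (c + δ / 2 - (c - δ / 2)) * (m * (A / 2) ^ s) := by ring
      _ ≤ _ := J
      _ ≤ _ := le_abs_self _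
      _ = _ := by rw [abs_mul, hσ, one_mul]

lemma aux_loc (a b : ℝ) (hab : a < b) (g : ℝ → ℝ) (hg : ContinuousOn g (Set.Icc a b))
    (hg0 : ∃ x ∈ Set.Icc a b, g x ≠ 0) : ∃ c r m σ : ℝ, 0 < r ∧ 0 < m ∧ |σ| = 1 ∧
    a ≤ c - r ∧ c + r ≤ b ∧ ∀ x ∈ Icc (c - r) (c + r), m ≤ σ * g x := by
  obtain ⟨x0, hx0, hne⟩ := hg0
  have hcl : x0 ∈ closure (Ioo a b) := by rwa [closure_Ioo hab.ne]
  have hev : ∀ᶠ x in 𝓝[Ioo a b] x0, g x ≠ 0 :=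
    ((hg x0 hx0).mono Ioo_subset_Icc_self).eventually_ne hne
  have := mem_closure_iff_nhdsWithin_neBot.1 hcl
  obtain ⟨c, hgc, hc⟩ := (hev.and self_mem_nhdsWithin).exists
  have hcc : ContinuousAt g c := hg.continuousAt (Icc_mem_nhds hc.1 hc.2)
  obtain ⟨σ, hσ, hpos⟩ : ∃ σ : ℝ, |σ| = 1 ∧ 0 < σ * g c := by
    rcases lt_or_gt_of_ne hgc with h | h
    · exact ⟨-1, by simp, by linarith⟩
    · exact ⟨1, by simp, by linarith⟩
  have h1 : ∀ᶠ x in 𝓝 c, σ * g c / 2 < σ * g x :=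
    (hcc.tendsto.const_mul σ).eventually (lt_mem_nhds (by linarith))
  obtain ⟨e, he, hball⟩ := Metric.eventually_nhds_iff.1 (h1.and (Ioo_mem_nhds hc.1 hc.2))
  have key : ∀ x ∈ Icc (c - e/2) (c + e/2), σ * g c / 2 < σ * g x ∧ x ∈ Ioo a b := fun x hx =>
    hball (by
      rw [Real.dist_eq, abs_lt]
      constructor <;> linarith [hx.1, hx.2])
  refine ⟨c, e/2, σ * g c / 2, σ, by linarith, by linarith, hσ, ?_, ?_, fun x hx => (key x hx).1.le⟩
  · exact (key (c - e/2) ⟨by linarith, by linarith⟩).2.1.le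
  · exact (key (c + e/2) ⟨by linarith, by linarith⟩).2.2.le

lemma aux_seq (a b : ℝ) (hab : a < b) (g : ℝ → ℝ) (hg : ContinuousOn g (Set.Icc a b))
    (hg0 : ∃ x ∈ Set.Icc a b, g x ≠ 0) (s : ℕ) (hs : 2 ≤ s) (p : ℝ)
    (hp1 : 1 ≤ p) (hps : p < s) :
    ∃ h : ℕ → ℝ → ℝ,
      (∀ n, C0 a b (h n) ∧ ∃ x ∈ Set.Icc a b, h n x ≠ 0) ∧
      (∀ n, 0 < pN a b p (h n)) ∧
      Tendsto (fun n => pN a b p (h n)) atTop (nhds 0) ∧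
      Tendsto (fun n => (1 / pN a b p (h n)) * |∫ x in a..b, g x * h n x ^ s|) atTop atTop := by
  obtain ⟨c, r, m, σ, hr, hm, hσ, hra, hrb, hgm⟩ := aux_loc a b hab g hg hg0
  have hp0 : 0 < p := by linarith
  have hs1 : (0:ℝ) < s - 1 := by linarith
  obtain ⟨α, hα1, hα2⟩ : ∃ α : ℝ, (1 - 1/p) / (s - 1) < α ∧ α < 1 / p := by
    apply exists_between
    rw [div_lt_div_iff₀ hs1 hp0, sub_mul, one_div, inv_mul_cancel₀ hp0.ne']
    linarith
  rw [div_lt_iff₀ hs1] at hα1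
  set d : ℕ → ℝ := fun n => r / ((n:ℝ) + 1) with hd
  have hdpos : ∀ n, 0 < d n := fun n => by positivity
  have hdle : ∀ n, d n ≤ r := fun n => div_le_self hr.le (by linarith [(Nat.cast_nonneg n : (0:ℝ) ≤ n)])
  have hd0 : Tendsto d atTop (𝓝 0) := by
    have := (tendsto_one_div_add_atTop_nhds_zero_nat (𝕜 := ℝ)).const_mul r
    simpa [hd, div_eq_mul_inv] using this
  have hd0' : Tendsto d atTop (𝓝[>] 0) :=
    tendsto_nhdsWithin_iff.2 ⟨hd0, Eventually.of_forall hdpos⟩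
  choose h hC hne hpos hup hlo using fun n => aux_bump a b g hg s hs p hp1 c r m σ hm hσ hra hrb hgm
    (d n) (d n ^ (-α)) (hdpos n) (hdle n) (Real.rpow_pos_of_pos (hdpos n) _)
  have hup' : ∀ n, pN a b p (h n) ≤ 2 ^ (1/p) * d n ^ (1/p - α) := fun n => by
    refine (hup n).trans_eq ?_
    have hn := hdpos n
    rw [Real.mul_rpow (by positivity) (by positivity), Real.mul_rpow (by positivity) hn.le,
      ← Real.rpow_mul hn.le, ← Real.rpow_mul hn.le, mul_assoc, ← Real.rpow_add hn]
    congr 2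
    field_simp
    ring
  refine ⟨h, fun n => ⟨hC n, hne n⟩, hpos, ?_, ?_⟩
  · refine squeeze_zero (fun n => (hpos n).le) hup' ?_
    have : Tendsto (fun n => d n ^ (1/p - α)) atTop (𝓝 (0 ^ (1/p - α))) :=
      hd0.rpow_const (Or.inr (by linarith))
    rw [Real.zero_rpow (by linarith)] at this
    simpa using this.const_mul (2 ^ (1/p))
  · have hlim : Tendsto (fun n => (m * (1/2)^s / 2^(1/p)) * d n ^ (1 - 1/p - α * (s - 1))) atTop atTop := by
      refine Tendsto.const_mul_atTop (by positivity) ?_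
      exact (tendsto_rpow_neg_nhdsGT_zero (by linarith)).comp hd0'
    refine tendsto_atTop_mono (fun n => ?_) hlim
    have hn := hdpos n
    rw [one_div_mul_eq_div]
    calc _ = (d n * (m * (d n ^ (-α) / 2) ^ s)) / (2 ^ (1/p) * d n ^ (1/p - α)) := by
          rw [div_pow (d n ^ (-α)), ← Real.rpow_natCast (d n ^ (-α)), ← Real.rpow_mul hn.le,
            show 1 - 1/p - α * ((s:ℝ) - 1) = 1 + (-α * s) - (1/p - α) by ring,
            Real.rpow_sub hn, Real.rpow_add hn, Real.rpow_one]
          simp only [div_pow, one_pow]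
          have q1 : 0 < d n ^ (1/p - α) := Real.rpow_pos_of_pos hn _
          have q2 : (0:ℝ) < 2 ^ (1/p) := by positivity
          generalize d n ^ (1/p - α) = y1 at q1 ⊢
          generalize (2:ℝ) ^ (1/p) = y2 at q2 ⊢
          generalize d n ^ (-α * (s:ℝ)) = y3
          field_simp
      _ ≤ |∫ x in a..b, g x * h n x ^ s| / (2 ^ (1/p) * d n ^ (1/p - α)) := by
          gcongr
          exact hlo n
      _ ≤ _ := div_le_div_of_nonneg_left (abs_nonneg _) (hpos n) (hup' n)

theorem stmt1 (a b : ℝ) (hab : a < b) (g : ℝ → ℝ) (hg : ContinuousOn g (Set.Icc a b))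
    (hg0 : ∃ x ∈ Set.Icc a b, g x ≠ 0) (s : ℕ) (hs : 2 ≤ s) (p : ℝ)
    (hp1 : 1 ≤ p) (hps : p < s) :
    (∃ h : ℕ → ℝ → ℝ,
      (∀ n, C0 a b (h n) ∧ ∃ x ∈ Set.Icc a b, h n x ≠ 0) ∧
      Tendsto (fun n => pN a b p (h n)) atTop (nhds 0) ∧
      Tendsto (fun n => (1 / pN a b p (h n)) * |∫ x in a..b, g x * h n x ^ s|) atTop atTop) ∧
    ¬ ∀ ε > 0, ∃ δ > 0, ∀ h : ℝ → ℝ, C0 a b h → 0 < pN a b p h → pN a b p h < δ →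
        |∫ x in a..b, g x * h x ^ s| ≤ ε * pN a b p h := by
  obtain ⟨h, h1, h2, h3, h4⟩ := aux_seq a b hab g hg hg0 s hs p hp1 hps
  refine ⟨⟨h, h1, h3, h4⟩, fun H => ?_⟩
  obtain ⟨δ, hδ, H⟩ := H 1 one_pos
  obtain ⟨n, hn1, hn2⟩ := ((h3.eventually (gt_mem_nhds hδ)).and (h4.eventually_gt_atTop 1)).exists
  have := H (h n) (h1 n).1 (h2 n) hn1
  rw [one_div_mul_eq_div, lt_div_iff₀ (h2 n)] at hn2
  linarith
end

section
/- Let p satisfy 1 ≤ p < 4. Then for every v ∈ C₀[a,b] there exists a sequence (h_n) in C₀[a,b] with h_n ≠ 0 for all n, ‖h_n‖_p → 0, and (K(v + h_n) − K(v) − T_v(h_n))/‖h_n‖_p → +∞. In particular, K is not Fréchet differentiable at v with respect to the norm ‖·‖_p. -/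
open Set MeasureTheory intervalIntegral Filter Topology

/-- The functional `K(v) = ∫_a^b θ(x) (H(v(x)) - F(x) v(x)) dx`,
with `H(y) = (1/2)((1/2)y² - λ)²`. -/
noncomputable def Kf (a b lam : ℝ) (θ F : ℝ → ℝ) (v : ℝ → ℝ) : ℝ :=
  ∫ x in a..b, θ x * ((1/2) * ((1/2) * v x ^ 2 - lam) ^ 2 - F x * v x)

/-- The linear functional `T_v(h) = ∫_a^b θ(x)(v(x)((1/2)v(x)² - λ) - F(x)) h(x) dx`. -/
noncomputable def Tf (a b lam : ℝ) (θ F : ℝ → ℝ) (v h : ℝ → ℝ) : ℝ :=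
  ∫ x in a..b, θ x * (v x * ((1/2) * v x ^ 2 - lam) - F x) * h x


/-- A tent of height `t`, half-width `w`, centered at `c`. -/
noncomputable def tent (c t w : ℝ) (x : ℝ) : ℝ := t * max 0 (1 - |x - c| / w)

lemma tent_cont (c t w : ℝ) : Continuous (tent c t w) := by
  unfold tent; fun_prop

lemma tent_nonneg (c t w x : ℝ) (ht : 0 ≤ t) : 0 ≤ tent c t w x := by
  unfold tent; positivity

lemma tent_le (c t w x : ℝ) (ht : 0 ≤ t) (hw : 0 < w) : tent c t w x ≤ t := by
  unfold tent
  have : max 0 (1 - |x - c| / w) ≤ 1 := by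
    apply max_le (by norm_num)
    have : 0 ≤ |x - c| / w := by positivity
    linarith
  nlinarith

lemma tent_zero (c t w x : ℝ) (hw : 0 < w) (h : w ≤ |x - c|) : tent c t w x = 0 := by
  unfold tent
  have : 1 ≤ |x - c| / w := by rwa [le_div_iff₀ hw, one_mul]
  rw [max_eq_left (by linarith), mul_zero]

lemma tent_ge (c t w x : ℝ) (ht : 0 ≤ t) (hw : 0 < w) (h : |x - c| ≤ w / 2) :
    t / 2 ≤ tent c t w x := by
  unfold tent
  have h1 : |x - c| / w ≤ 1 / 2 := by rw [div_le_iff₀ hw]; linarith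
  have : 1 / 2 ≤ max 0 (1 - |x - c| / w) := le_max_of_le_right (by linarith)
  nlinarith

lemma tent_upper (a b c t w q : ℝ) (ht : 0 ≤ t) (hw : 0 < w) (hq : 0 < q)
    (h1 : a ≤ c - w) (h2 : c + w ≤ b) :
    ∫ x in a..b, |tent c t w x| ^ q ≤ t ^ q * (2 * w) := by
  have key : ∀ x, |tent c t w x| ^ q ≠ 0 → |x - c| < w := by
    intro x hx
    by_contra hc
    apply hx
    rw [tent_zero c t w x hw (not_lt.mp hc), abs_zero, Real.zero_rpow hq.ne']
  rw [integral_eq_integral_of_support_subset, ← integral_eq_integral_of_support_subset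
    (a := c - w) (b := c + w)]
  · have := intervalIntegral.norm_integral_le_of_norm_le_const (a := c - w) (b := c + w)
      (f := fun x => |tent c t w x| ^ q) (C := t ^ q) (by
        intro x _
        rw [Real.norm_of_nonneg (by positivity), abs_of_nonneg (tent_nonneg c t w x ht)]
        exact Real.rpow_le_rpow (tent_nonneg c t w x ht) (tent_le c t w x ht hw) hq.le)
    refine (le_abs_self _).trans (this.trans (le_of_eq ?_))
    rw [show c + w - (c - w) = 2 * w by ring, abs_of_pos (by linarith)]
  · intro x hx
    have := abs_lt.mp (key x hx)
    constructor <;> linarith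
  · intro x hx
    have := abs_lt.mp (key x hx)
    constructor <;> linarith

lemma tent_lower (a b c t w q : ℝ) (ht : 0 ≤ t) (hw : 0 < w) (hq : 0 < q)
    (h1 : a ≤ c - w) (h2 : c + w ≤ b) :
    (t / 2) ^ q * w ≤ ∫ x in a..b, |tent c t w x| ^ q := by
  have hc : Continuous (fun x => |tent c t w x| ^ q) :=
    (tent_cont c t w).abs.rpow_const (fun x => Or.inr hq.le)
  have e1 : ∫ x in (c - w / 2)..(c + w / 2), (t / 2) ^ q = (t / 2) ^ q * w := by
    rw [intervalIntegral.integral_const, smul_eq_mul]; ring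
  rw [← e1]
  calc _ ≤ ∫ x in (c - w / 2)..(c + w / 2), |tent c t w x| ^ q := by
        apply intervalIntegral.integral_mono_on (by linarith) (by simp) (hc.intervalIntegrable _ _)
        intro x hx
        have hg := tent_ge c t w x ht hw (abs_le.mpr ⟨by linarith [hx.1], by linarith [hx.2]⟩)
        exact Real.rpow_le_rpow (by positivity) (hg.trans (le_abs_self _)) hq.le
    _ ≤ _ := by
        apply intervalIntegral.integral_mono_interval (by linarith) (by linarith) (by linarith)
          _ (hc.intervalIntegrable _ _)
        exact Filter.Eventually.of_forall (fun x => by positivity)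

lemma remainder_ge (v h l : ℝ) :
    h ^ 4 / 24 - l / 2 * h ^ 2 ≤
      (1/2) * ((1/2) * (v + h) ^ 2 - l) ^ 2 - (1/2) * ((1/2) * v ^ 2 - l) ^ 2
        - v * ((1/2) * v ^ 2 - l) * h := by
  have : 0 ≤ h ^ 2 * (h + 3 * v) ^ 2 / 12 := by positivity
  linarith

lemma main_lower (a b lam m M : ℝ) (hab : a < b) (hlam : 0 < lam)
    (θ : ℝ → ℝ) (hθc : ContinuousOn θ (Set.Icc a b)) (hm : ∀ x ∈ Set.Icc a b, m ≤ θ x)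
    (hm0 : 0 < m) (hM : ∀ x ∈ Set.Icc a b, θ x ≤ M)
    (F : ℝ → ℝ) (hF : ContinuousOn F (Set.Icc a b))
    (v h : ℝ → ℝ) (hv : ContinuousOn v (Set.Icc a b)) (hh : Continuous h) :
    m / 24 * (∫ x in a..b, |h x| ^ (4:ℝ)) - M * lam / 2 * (∫ x in a..b, |h x| ^ (2:ℝ)) ≤
      Kf a b lam θ F (v + h) - Kf a b lam θ F v - Tf a b lam θ F v h := by
  have hh' : ContinuousOn h (Set.Icc a b) := hh.continuousOn
  have e4 : ∀ x, |h x| ^ (4:ℝ) = h x ^ 4 := fun x => by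
    rw [show (4:ℝ) = ((4:ℕ):ℝ) by norm_num, Real.rpow_natCast]
    exact Even.pow_abs (by decide) _
  have e2 : ∀ x, |h x| ^ (2:ℝ) = h x ^ 2 := fun x => by
    rw [show (2:ℝ) = ((2:ℕ):ℝ) by norm_num, Real.rpow_natCast]
    exact Even.pow_abs (by decide) _
  simp only [e4, e2]
  unfold Kf Tf
  have I : ∀ f : ℝ → ℝ, ContinuousOn f (Set.Icc a b) → IntervalIntegrable f volume a b :=
    fun f hf => ContinuousOn.intervalIntegrable_of_Icc hab.le hf
  rw [← intervalIntegral.integral_const_mul, ← intervalIntegral.integral_const_mul,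
    ← intervalIntegral.integral_sub, ← intervalIntegral.integral_sub,
    ← intervalIntegral.integral_sub]
  · apply intervalIntegral.integral_mono_on hab.le
    · apply I; fun_prop
    · apply I; simp only [Pi.add_apply]; fun_prop
    intro x hx
    simp only [Pi.add_apply]
    have r := remainder_ge (v x) (h x) lam
    have h1 := hm x hx
    have h2 := hM x hx
    have r2 := mul_le_mul_of_nonneg_left r (hm0.le.trans h1)
    have r3 : 0 ≤ (θ x - m) * (h x ^ 4 / 24) := mul_nonneg (by linarith) (by positivity)
    have r4 : 0 ≤ (M - θ x) * (lam / 2 * h x ^ 2) := mul_nonneg (by linarith) (by positivity)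
    linarith
  all_goals apply I; try simp only [Pi.add_apply]
  all_goals fun_prop

theorem stmt4 (a b lam : ℝ) (hab : a < b) (hlam : 0 < lam)
    (θ : ℝ → ℝ) (hθc : ContinuousOn θ (Set.Icc a b)) (hθ : ∀ x ∈ Set.Icc a b, 0 < θ x)
    (F : ℝ → ℝ) (hF : ContDiffOn ℝ 1 F (Set.Icc a b)) (hFa : F a = 0) (hFb : F b = 0)
    (hFne : ∀ x ∈ Set.Ioo a b, F x ≠ 0)
    (hFsmall : sSup ((fun x => |F x|) '' Set.Icc a b) < (2 * lam / 3) ^ ((3 : ℝ) / 2))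
    (p : ℝ) (hp1 : 1 ≤ p) (hp4 : p < 4) :
    ∀ v : ℝ → ℝ, C0 a b v →
      (∃ h : ℕ → ℝ → ℝ,
        (∀ n, C0 a b (h n) ∧ ∃ x ∈ Set.Icc a b, h n x ≠ 0) ∧
        Tendsto (fun n => pN a b p (h n)) atTop (nhds 0) ∧
        Tendsto (fun n =>
          (Kf a b lam θ F (v + h n) - Kf a b lam θ F v - Tf a b lam θ F v (h n)) /
            pN a b p (h n)) atTop atTop) ∧
      ¬ ∀ ε > 0, ∃ δ > 0, ∀ h : ℝ → ℝ, C0 a b h → 0 < pN a b p h → pN a b p h < δ →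
          |Kf a b lam θ F (v + h) - Kf a b lam θ F v - Tf a b lam θ F v h| ≤ ε * pN a b p h := by
  intro v hv
  obtain ⟨x0, hx0, hmin⟩ := isCompact_Icc.exists_isMinOn (nonempty_Icc.mpr hab.le) hθc
  obtain ⟨x1, hx1, hmax⟩ := isCompact_Icc.exists_isMaxOn (nonempty_Icc.mpr hab.le) hθc
  have hm0 := hθ x0 hx0
  have hM0 := hθ x1 hx1
  set m := θ x0
  set M := θ x1
  have hp0 : 0 < p := by linarith
  obtain ⟨d, hd⟩ : ∃ d, d = (b - a) / 2 := ⟨_, rfl⟩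
  obtain ⟨c, hc⟩ : ∃ c, c = (a + b) / 2 := ⟨_, rfl⟩
  have hd0 : 0 < d := by rw [hd]; linarith
  let t : ℕ → ℝ := fun n => (n : ℝ) + 1
  have ht1 : ∀ n, 1 ≤ t n := fun n => by simp [t]
  have ht0 : ∀ n, 0 < t n := fun n => by linarith [ht1 n]
  have htt : Tendsto t atTop atTop :=
    tendsto_atTop_add_const_right _ _ tendsto_natCast_atTop_atTop
  let w : ℕ → ℝ := fun n => d / t n ^ (4:ℝ)
  have hw0 : ∀ n, 0 < w n := fun n => div_pos hd0 (Real.rpow_pos_of_pos (ht0 n) _)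
  have hwd : ∀ n, w n ≤ d := fun n =>
    div_le_self hd0.le (Real.one_le_rpow (ht1 n) (by norm_num))
  have hl : ∀ n, a ≤ c - w n := fun n => by linarith [hwd n]
  have hr : ∀ n, c + w n ≤ b := fun n => by linarith [hwd n]
  let h : ℕ → ℝ → ℝ := fun n => tent c (t n) (w n)
  have hC0 : ∀ n, C0 a b (h n) := fun n => by
    refine ⟨(tent_cont _ _ _).continuousOn, tent_zero _ _ _ _ (hw0 n) ?_,
      tent_zero _ _ _ _ (hw0 n) ?_⟩
    · rw [abs_of_neg (by linarith [hl n, hw0 n])]; linarith [hl n]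
    · rw [abs_of_pos (by linarith [hr n, hw0 n])]; linarith [hr n]
  have hup : ∀ q : ℝ, 0 < q → ∀ n, ∫ x in a..b, |h n x| ^ q ≤ 2 * d * t n ^ (-(4 - q)) := by
    intro q hq n
    refine (tent_upper a b c (t n) (w n) q (ht0 n).le (hw0 n) hq (hl n) (hr n)).trans_eq ?_
    rw [show -(4 - q) = q - 4 by ring, Real.rpow_sub (ht0 n)]
    simp only [w]; ring
  have hlim : ∀ q : ℝ, 0 < q → q < 4 →
      Tendsto (fun n => ∫ x in a..b, |h n x| ^ q) atTop (𝓝 0) := by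
    intro q hq hq4
    have h1 : Tendsto (fun n => 2 * d * t n ^ (-(4 - q))) atTop (𝓝 0) := by
      have := ((tendsto_rpow_neg_atTop (show 0 < 4 - q by linarith)).comp htt).const_mul (2 * d)
      simpa using this
    refine squeeze_zero (fun n => ?_) (hup q hq) h1
    exact intervalIntegral.integral_nonneg hab.le (fun x _ => by positivity)
  have hpos : ∀ n, 0 < ∫ x in a..b, |h n x| ^ p := fun n => by
    refine lt_of_lt_of_le ?_
      (tent_lower a b c (t n) (w n) p (ht0 n).le (hw0 n) hp0 (hl n) (hr n))
    have := ht0 n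
    have := hw0 n
    positivity
  have hpN0 : ∀ n, 0 < pN a b p (h n) := fun n => Real.rpow_pos_of_pos (hpos n) _
  have hpN : Tendsto (fun n => pN a b p (h n)) atTop (𝓝 0) := by
    have := (hlim p hp0 hp4).rpow_const (p := 1 / p) (Or.inr (by positivity))
    rwa [Real.zero_rpow (by positivity)] at this
  have h4 : ∀ n, d / 16 ≤ ∫ x in a..b, |h n x| ^ (4:ℝ) := fun n => by
    refine le_trans (le_of_eq ?_)
      (tent_lower a b c (t n) (w n) 4 (ht0 n).le (hw0 n) (by norm_num) (hl n) (hr n))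
    have := Real.rpow_pos_of_pos (ht0 n) 4
    rw [Real.div_rpow (ht0 n).le (by norm_num)]
    simp only [w]
    rw [show (2:ℝ) ^ (4:ℝ) = 16 by norm_num]
    field_simp
  have hnum : ∀ᶠ n in atTop, m * d / 768 ≤
      Kf a b lam θ F (v + h n) - Kf a b lam θ F v - Tf a b lam θ F v (h n) := by
    have h2 := (hlim 2 (by norm_num) (by norm_num)).const_mul (M * lam / 2)
    rw [mul_zero] at h2
    filter_upwards [h2.eventually (gt_mem_nhds (show 0 < m * d / 768 by positivity))] with n hn
    refine le_trans ?_ (main_lower a b lam m M hab hlam θ hθc (fun x hx => hmin hx) hm0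
      (fun x hx => hmax hx) F hF.continuousOn v (h n) hv.1 (tent_cont _ _ _))
    have := mul_le_mul_of_nonneg_left (h4 n) (show 0 ≤ m / 24 by positivity)
    linarith
  have hratio : Tendsto (fun n =>
          (Kf a b lam θ F (v + h n) - Kf a b lam θ F v - Tf a b lam θ F v (h n)) /
            pN a b p (h n)) atTop atTop := by
    have hinv : Tendsto (fun n => (pN a b p (h n))⁻¹) atTop atTop :=
      tendsto_inv_nhdsGT_zero.comp (tendsto_nhdsWithin_iff.mpr
        ⟨hpN, Filter.Eventually.of_forall hpN0⟩)
    refine tendsto_atTop_mono' _ ?_ (hinv.const_mul_atTop (show 0 < m * d / 768 by positivity))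
    filter_upwards [hnum] with n hn
    rw [div_eq_mul_inv]
    exact mul_le_mul_of_nonneg_right hn (inv_nonneg.mpr (hpN0 n).le)
  refine ⟨⟨h, fun n => ⟨hC0 n, c, ⟨by linarith, by linarith⟩, ?_⟩, hpN, hratio⟩, ?_⟩
  · have := tent_ge c (t n) (w n) c (ht0 n).le (hw0 n) (by rw [sub_self, abs_zero]; linarith [hw0 n])
    exact ne_of_gt (lt_of_lt_of_le (half_pos (ht0 n)) this)
  · intro H
    obtain ⟨δ, hδ, H⟩ := H 1 one_pos
    obtain ⟨n, hn1, hn2⟩ := ((hpN.eventually (gt_mem_nhds hδ)).and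
      (hratio.eventually_gt_atTop 1)).exists
    have := H (h n) (hC0 n) (hpN0 n) hn1
    rw [lt_div_iff₀ (hpN0 n)] at hn2
    exact absurd (hn2.trans_le ((le_abs_self _).trans this)) (lt_irrefl _)
end

section
/- A function v ∈ C₀[a,b] satisfies T_v(h) = 0 for every h ∈ C₀[a,b] if and only if v(x) = z₂(F(x)) for every x ∈ [a,b]. In other words, K has exactly one stationary point, namely v̄ := z₂ ∘ F, where for each x ∈ [a,b], v̄(x) is the unique solution z ∈ (−√(2λ/3), √(2λ/3)) of the equation z((1/2)z² − λ) = F(x). -/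
open Set MeasureTheory intervalIntegral

/-- The supremum norm of `h` on `[a,b]`. -/
noncomputable def supN (a b : ℝ) (h : ℝ → ℝ) : ℝ := sSup ((fun x => |h x|) '' Set.Icc a b)

theorem stmt7 (a b lam : ℝ) (hab : a < b) (hlam : 0 < lam)
    (θ : ℝ → ℝ) (hθc : ContinuousOn θ (Set.Icc a b)) (hθ : ∀ x ∈ Set.Icc a b, 0 < θ x)
    (F : ℝ → ℝ) (hF : ContDiffOn ℝ 1 F (Set.Icc a b)) (hFa : F a = 0) (hFb : F b = 0)
    (hFne : ∀ x ∈ Set.Ioo a b, F x ≠ 0)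
    (hFsmall : supN a b F < (2 * lam / 3) ^ ((3 : ℝ) / 2))
    (κ : ℝ) (hκ : κ = Real.sqrt (2 * lam / 3))
    (z₂ : ℝ → ℝ)
    (hz₂ : ∀ A ∈ Set.Ioo (-κ ^ 3) (κ ^ 3),
      z₂ A ∈ Set.Ioo (-κ) κ ∧ z₂ A * ((1/2) * (z₂ A) ^ 2 - lam) = A ∧
      ∀ z ∈ Set.Ioo (-κ) κ, z * ((1/2) * z ^ 2 - lam) = A → z = z₂ A) :
    ∀ v : ℝ → ℝ, C0 a b v →
      ((∀ h : ℝ → ℝ, C0 a b h → Tf a b lam θ F v h = 0) ↔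
        ∀ x ∈ Set.Icc a b, v x = z₂ (F x)) := by
  have hk0 : 0 < κ := by rw [hκ]; positivity
  have hk2 : κ ^ 2 = 2 * lam / 3 := by rw [hκ]; exact Real.sq_sqrt (by positivity)
  have hl : lam = 3 / 2 * κ ^ 2 := by linarith
  have hk3 : (2 * lam / 3) ^ ((3 : ℝ) / 2) = κ ^ 3 := by
    rw [← hk2, ← Real.rpow_natCast κ 2, ← Real.rpow_mul hk0.le, ← Real.rpow_natCast κ 3]
    norm_num
  rw [hk3] at hFsmall
  have hFc : ContinuousOn F (Set.Icc a b) := hF.continuousOn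
  have hFb' : ∀ x ∈ Set.Icc a b, F x ∈ Set.Ioo (-κ ^ 3) (κ ^ 3) := by
    intro x hx
    have hbd : BddAbove ((fun x => |F x|) '' Set.Icc a b) :=
      (isCompact_Icc.image_of_continuousOn hFc.abs).bddAbove
    have h1 : |F x| ≤ supN a b F := le_csSup hbd ⟨x, hx, rfl⟩
    have h2 := abs_lt.mp (lt_of_le_of_lt h1 hFsmall)
    exact ⟨h2.1, h2.2⟩
  intro v hv
  obtain ⟨hvc, hva, hvb⟩ := hv
  constructor
  · intro hT
    have hgc : ContinuousOn (fun x => v x * ((1/2) * v x ^ 2 - lam) - F x) (Set.Icc a b) := by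
      fun_prop
    have hT0 := hT (fun x => v x * ((1/2) * v x ^ 2 - lam) - F x)
      ⟨hgc, by simp [hva, hFa], by simp [hvb, hFb]⟩
    have hg : ∀ x ∈ Set.Icc a b, v x * ((1/2) * v x ^ 2 - lam) = F x := by
      intro x hx
      by_contra hne
      have hpos : 0 < Tf a b lam θ F v (fun x => v x * ((1/2) * v x ^ 2 - lam) - F x) := by
        unfold Tf
        refine intervalIntegral.integral_pos hab ((hθc.mul hgc).mul hgc) ?_ ⟨x, hx, ?_⟩
        · intro y hy
          have := hθ y ⟨hy.1.le, hy.2⟩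
          rw [mul_assoc]
          exact mul_nonneg this.le (mul_self_nonneg _)
        · rw [mul_assoc]
          exact mul_pos (hθ x hx) (mul_self_pos.mpr (sub_ne_zero.mpr hne))
      linarith
    have hnk : ∀ x ∈ Set.Icc a b, |v x| ≠ κ := by
      intro x hx h
      have h1 := hg x hx
      have h2 := hFb' x hx
      rw [hl] at h1
      rcases (abs_eq hk0.le).mp h with h | h
      · rw [h] at h1; have := h2.1; nlinarith
      · rw [h] at h1; have := h2.2; nlinarith
    intro x hx
    have hlt : |v x| < κ := by
      by_contra hge
      push Not at hge
      have hsub : Set.Icc a x ⊆ Set.Icc a b := Set.Icc_subset_Icc le_rfl hx.2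
      have hiv := intermediate_value_Icc hx.1 (hvc.abs.mono hsub)
      obtain ⟨y, hy, hyk⟩ := hiv ⟨by simp [hva, hk0.le], hge⟩
      exact hnk y (hsub hy) hyk
    exact (hz₂ (F x) (hFb' x hx)).2.2 (v x) (abs_lt.mp hlt) (hg x hx)
  · intro hvz h _
    unfold Tf
    rw [intervalIntegral.integral_congr (g := fun _ => (0 : ℝ))]
    · simp
    · intro x hx
      rw [Set.uIcc_of_le hab.le] at hx
      have h1 := (hz₂ (F x) (hFb' x hx)).2.1
      rw [← hvz x hx] at h1
      simp only [h1, sub_self, mul_zero, zero_mul]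
end

section
/- The function v̄ := z₂ ∘ F belongs to C₀[a,b] and is a strict local maximizer of K with respect to the supremum norm: there exists ε > 0 such that for every h ∈ C₀[a,b] with 0 < ‖h‖_∞ < ε one has K(v̄ + h) < K(v̄). -/
open Set MeasureTheory intervalIntegral

theorem abs_le_supN {a b : ℝ} {h : ℝ → ℝ} (hc : ContinuousOn h (Set.Icc a b)) {x : ℝ}
    (hx : x ∈ Set.Icc a b) : |h x| ≤ supN a b h :=
  le_csSup (isCompact_Icc.image_of_continuousOn hc.abs).bddAbove ⟨x, hx, rfl⟩

set_option maxHeartbeats 1000000 in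
theorem stmt8 (a b lam : ℝ) (hab : a < b) (hlam : 0 < lam)
    (θ : ℝ → ℝ) (hθc : ContinuousOn θ (Set.Icc a b)) (hθ : ∀ x ∈ Set.Icc a b, 0 < θ x)
    (F : ℝ → ℝ) (hF : ContDiffOn ℝ 1 F (Set.Icc a b)) (hFa : F a = 0) (hFb : F b = 0)
    (hFne : ∀ x ∈ Set.Ioo a b, F x ≠ 0)
    (hFsmall : supN a b F < (2 * lam / 3) ^ ((3 : ℝ) / 2))
    (κ : ℝ) (hκ : κ = Real.sqrt (2 * lam / 3))
    (z₂ : ℝ → ℝ)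
    (hz₂ : ∀ A ∈ Set.Ioo (-κ ^ 3) (κ ^ 3),
      z₂ A ∈ Set.Ioo (-κ) κ ∧ z₂ A * ((1/2) * (z₂ A) ^ 2 - lam) = A ∧
      ∀ z ∈ Set.Ioo (-κ) κ, z * ((1/2) * z ^ 2 - lam) = A → z = z₂ A) :
    C0 a b (fun x => z₂ (F x)) ∧
    ∃ ε > 0, ∀ h : ℝ → ℝ, C0 a b h → 0 < supN a b h → supN a b h < ε →
      Kf a b lam θ F ((fun x => z₂ (F x)) + h) < Kf a b lam θ F (fun x => z₂ (F x)) := by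
  have hκ2 : κ ^ 2 = 2 * lam / 3 := by rw [hκ]; exact Real.sq_sqrt (by positivity)
  have hκ0 : 0 < κ := by rw [hκ]; exact Real.sqrt_pos.2 (by positivity)
  have hl : lam = 3 / 2 * κ ^ 2 := by linarith
  have hκ3 : (2 * lam / 3) ^ ((3 : ℝ) / 2) = κ ^ 3 := by
    rw [hκ, Real.sqrt_eq_rpow, ← Real.rpow_natCast, ← Real.rpow_mul (by positivity)]
    norm_num
  rw [hκ3] at hFsmall
  have hFc := hF.continuousOn
  obtain ⟨M, hM⟩ : ∃ M, M = supN a b F := ⟨_, rfl⟩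
  have hFM : ∀ x ∈ Icc a b, |F x| ≤ M := fun x hx => hM ▸ abs_le_supN hFc hx
  have hM0 : 0 ≤ M := (abs_nonneg _).trans (hFM a (left_mem_Icc.2 hab.le))
  rw [← hM] at hFsmall
  have hk3 : 0 < κ ^ 3 := by positivity
  obtain ⟨hm1, hm2, -⟩ := hz₂ M ⟨by linarith, hFsmall⟩
  obtain ⟨m, hm⟩ : ∃ m, m = - z₂ M := ⟨_, rfl⟩
  have hzm : z₂ M = -m := by linarith
  rw [hzm] at hm1 hm2
  have hmlt : m < κ := by linarith [hm1.1]
  have hmgt : -κ < m := by linarith [hm1.2]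
  have hD : 0 < κ ^ 2 - m ^ 2 := by nlinarith
  -- negativity of the difference quotient
  have hanti : ∀ z w : ℝ, -κ < z → z < κ → -κ < w → w < κ → z < w →
      w * ((1/2) * w ^ 2 - lam) < z * ((1/2) * z ^ 2 - lam) := by
    intro z w h1 h2 h3 h4 h5
    have e : z * ((1/2) * z ^ 2 - lam) - w * ((1/2) * w ^ 2 - lam)
        = (w - z) * (((κ ^ 2 - z ^ 2) + (κ ^ 2 - w ^ 2)) * (3 / 4) + (z - w) ^ 2 / 4) := by
      rw [hl]; ring
    have a1 : 0 < κ ^ 2 - z ^ 2 := by nlinarith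
    have a2 : 0 < κ ^ 2 - w ^ 2 := by nlinarith
    have : 0 < (w - z) * (((κ ^ 2 - z ^ 2) + (κ ^ 2 - w ^ 2)) * (3 / 4) + (z - w) ^ 2 / 4) :=
      mul_pos (by linarith) (by positivity)
    linarith
  have hFI : ∀ x ∈ Icc a b, F x ∈ Ioo (-κ ^ 3) (κ ^ 3) := fun x hx =>
    ⟨by linarith [(abs_le.1 (hFM x hx)).1], by linarith [(abs_le.1 (hFM x hx)).2]⟩
  have hv : ∀ x ∈ Icc a b, |z₂ (F x)| ≤ m := by
    intro x hx
    obtain ⟨h1, h2, -⟩ := hz₂ _ (hFI x hx)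
    have h3 := abs_le.1 (hFM x hx)
    rw [abs_le]
    constructor
    · by_contra! hlt
      have := hanti _ _ h1.1 h1.2 hm1.1 hm1.2 hlt
      linarith
    · by_contra! hlt
      have := hanti _ _ hmgt hmlt h1.1 h1.2 hlt
      linarith
  have hve : ∀ x ∈ Icc a b, z₂ (F x) * ((1/2) * (z₂ (F x)) ^ 2 - lam) = F x :=
    fun x hx => (hz₂ _ (hFI x hx)).2.1
  have hm0 : 0 ≤ m := (abs_nonneg _).trans (hv a (left_mem_Icc.2 hab.le))
  have hvsq : ∀ x ∈ Icc a b, z₂ (F x) ^ 2 ≤ m ^ 2 := fun x hx => by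
    rw [← sq_abs]; exact pow_le_pow_left₀ (abs_nonneg _) (hv x hx) 2
  have hlip : ∀ x ∈ Icc a b, ∀ y ∈ Icc a b,
      |z₂ (F x) - z₂ (F y)| ≤ (3 / 2 * (κ ^ 2 - m ^ 2))⁻¹ * |F x - F y| := by
    intro x hx y hy
    rw [inv_mul_eq_div, le_div_iff₀ (by positivity)]
    have e : F x - F y = (z₂ (F x) - z₂ (F y)) * -(((κ ^ 2 - z₂ (F x) ^ 2)
        + (κ ^ 2 - z₂ (F y) ^ 2)) * (3 / 4) + (z₂ (F x) - z₂ (F y)) ^ 2 / 4) := by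
      nth_rewrite 1 [← hve x hx, ← hve y hy]
      rw [hl]; ring
    rw [e, abs_mul, abs_neg]
    apply mul_le_mul_of_nonneg_left _ (abs_nonneg _)
    refine le_trans ?_ (le_abs_self _)
    nlinarith [hvsq x hx, hvsq y hy, sq_nonneg (z₂ (F x) - z₂ (F y))]
  have hvc : ContinuousOn (fun x => z₂ (F x)) (Icc a b) := by
    intro x hx
    have h1 : Filter.Tendsto (fun y => (3 / 2 * (κ ^ 2 - m ^ 2))⁻¹ * |F y - F x|)
        (nhdsWithin x (Icc a b)) (nhds 0) := by
      have : ContinuousWithinAt (fun y => (3 / 2 * (κ ^ 2 - m ^ 2))⁻¹ * |F y - F x|)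
          (Icc a b) x :=
        continuousWithinAt_const.mul ((hFc x hx).sub continuousWithinAt_const).abs
      simpa [ContinuousWithinAt] using this
    rw [ContinuousWithinAt, tendsto_iff_dist_tendsto_zero]
    refine squeeze_zero' (Filter.Eventually.of_forall fun _ => dist_nonneg) ?_ h1
    filter_upwards [self_mem_nhdsWithin] with y hy
    rw [Real.dist_eq]
    exact hlip y hy x hx
  have hz0 : z₂ 0 = 0 :=
    ((hz₂ 0 ⟨by linarith, hk3⟩).2.2 0 ⟨by linarith, hκ0⟩ (by ring)).symm
  refine ⟨⟨hvc, by simp [hFa, hz0], by simp [hFb, hz0]⟩, (κ ^ 2 - m ^ 2) / κ, by positivity, ?_⟩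
  rintro h ⟨hhc, -, -⟩ hpos hlt
  -- pointwise bound
  have key : ∀ x ∈ Icc a b,
      ((1/2) * ((1/2) * (z₂ (F x) + h x) ^ 2 - lam) ^ 2 - F x * (z₂ (F x) + h x))
      ≤ ((1/2) * ((1/2) * z₂ (F x) ^ 2 - lam) ^ 2 - F x * z₂ (F x))
        - h x ^ 2 * ((κ ^ 2 - m ^ 2) / 8) := by
    intro x hx
    have hh : |h x| ≤ (κ ^ 2 - m ^ 2) / κ := (abs_le_supN hhc hx).trans hlt.le
    have hh1 : κ * |h x| ≤ κ ^ 2 - m ^ 2 := by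
      rw [le_div_iff₀ hκ0] at hh; linarith
    have hhk : |h x| ≤ κ := by
      by_contra! hc
      nlinarith
    have hh2 : h x ^ 2 ≤ κ ^ 2 - m ^ 2 := by
      rw [← sq_abs]; nlinarith [abs_nonneg (h x)]
    have hvh : z₂ (F x) * h x ≤ κ ^ 2 - m ^ 2 := by
      refine (le_abs_self _).trans ?_
      rw [abs_mul]
      exact (mul_le_mul_of_nonneg_right ((hv x hx).trans hmlt.le) (abs_nonneg _)).trans hh1
    have hq := hvsq x hx
    have e1 := hve x hx
    generalize z₂ (F x) = v at *
    generalize h x = t at *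
    rw [← e1, hl]
    have : 0 ≤ t ^ 2 * (3 / 4 * (κ ^ 2 - v ^ 2) - v * t / 2 - t ^ 2 / 8
        - (κ ^ 2 - m ^ 2) / 8) := by
      apply mul_nonneg (sq_nonneg _)
      linarith
    linarith
  obtain ⟨c, hc, hcne⟩ : ∃ c ∈ Icc a b, h c ≠ 0 := by
    by_contra! hcon
    have : supN a b h ≤ 0 := by
      apply csSup_le ((nonempty_Icc.2 hab.le).image _)
      rintro _ ⟨x, hx, rfl⟩
      simp [hcon x hx]
    linarith
  have hcont : ∀ v : ℝ → ℝ, ContinuousOn v (Icc a b) → ContinuousOn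
      (fun x => θ x * ((1/2) * ((1/2) * v x ^ 2 - lam) ^ 2 - F x * v x)) (Icc a b) := by
    intro v hv'
    exact hθc.mul ((continuousOn_const.mul (((continuousOn_const.mul (hv'.pow 2)).sub
      continuousOn_const).pow 2)).sub (hFc.mul hv'))
  unfold Kf
  apply intervalIntegral.integral_lt_integral_of_continuousOn_of_le_of_exists_lt hab
  · exact hcont _ (hvc.add hhc)
  · exact hcont _ hvc
  · intro x hx
    have hx' := Ioc_subset_Icc_self hx
    apply mul_le_mul_of_nonneg_left _ (hθ x hx').le
    have h1 := key x hx'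
    have h2 : 0 ≤ h x ^ 2 * ((κ ^ 2 - m ^ 2) / 8) := by positivity
    simp only [Pi.add_apply]
    linarith
  · refine ⟨c, hc, ?_⟩
    apply mul_lt_mul_of_pos_left _ (hθ c hc)
    have h1 := key c hc
    have h2 : 0 < h c ^ 2 * ((κ ^ 2 - m ^ 2) / 8) := by positivity
    simp only [Pi.add_apply]
    linarith
end

section
/- Assume the function x ↦ θ(x)F(x) is differentiable on [a,b] with derivative −θf. Endow C¹[a,b] with the norm ‖u‖ := ‖u‖_∞ + ‖u'‖_∞ and C₀[a,b] with ‖·‖_∞. (a) If ū is a local minimizer (respectively, local maximizer) of J restricted to C_{1,0}[a,b], then ū' is a local minimizer (respectively, local maximizer) of K on C₀[a,b]. (b) Conversely, if v̄ ∈ C₀[a,b] is a local minimizer (respectively, local maximizer) of K and u₀ ∈ ℝ, then the function ū defined by ū(x) := u₀ + ∫_a^x v̄(ξ) dξ belongs to C_{1,0}[a,b] and is a local minimizer (respectively, local maximizer) of J restricted to C_{1,0}[a,b]. -/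
open Set MeasureTheory intervalIntegral

/-- `u ∈ C¹[a,b]` with derivative `u'` on `[a,b]`. -/
def IsC1 (a b : ℝ) (u u' : ℝ → ℝ) : Prop :=
  (∀ x ∈ Set.Icc a b, HasDerivWithinAt u (u' x) (Set.Icc a b) x) ∧
    ContinuousOn u' (Set.Icc a b)

/-- `u ∈ C_{1,0}[a,b]`: `u ∈ C¹[a,b]` (with derivative `u'`) and `u'(a) = u'(b) = 0`. -/
def C10 (a b : ℝ) (u u' : ℝ → ℝ) : Prop := IsC1 a b u u' ∧ u' a = 0 ∧ u' b = 0

/-- The functional `J(u) = ∫_a^b θ(x) (H(u'(x)) - f(x) u(x)) dx`,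
with `H(y) = (1/2)((1/2)y² - λ)²`. -/
noncomputable def Jf (a b lam : ℝ) (θ f : ℝ → ℝ) (u u' : ℝ → ℝ) : ℝ :=
  ∫ x in a..b, θ x * ((1/2) * ((1/2) * u' x ^ 2 - lam) ^ 2 - f x * u x)

/-- `v` is a local minimizer of `K` on `C₀[a,b]` w.r.t. the sup norm. -/
noncomputable def KlocMin (a b lam : ℝ) (θ F : ℝ → ℝ) (v : ℝ → ℝ) : Prop :=
  C0 a b v ∧ ∃ r > 0, ∀ w : ℝ → ℝ, C0 a b w → supN a b (w - v) < r →
    Kf a b lam θ F v ≤ Kf a b lam θ F w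

/-- `v` is a local maximizer of `K` on `C₀[a,b]` w.r.t. the sup norm. -/
noncomputable def KlocMax (a b lam : ℝ) (θ F : ℝ → ℝ) (v : ℝ → ℝ) : Prop :=
  C0 a b v ∧ ∃ r > 0, ∀ w : ℝ → ℝ, C0 a b w → supN a b (w - v) < r →
    Kf a b lam θ F w ≤ Kf a b lam θ F v

/-- `u` is a local minimizer of `J` restricted to `C_{1,0}[a,b]`,
w.r.t. the norm `‖u‖ = ‖u‖_∞ + ‖u'‖_∞` on `C¹[a,b]`. -/
noncomputable def JlocMin (a b lam : ℝ) (θ f : ℝ → ℝ) (u u' : ℝ → ℝ) : Prop :=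
  C10 a b u u' ∧ ∃ r > 0, ∀ w w' : ℝ → ℝ, C10 a b w w' →
    supN a b (w - u) + supN a b (w' - u') < r →
    Jf a b lam θ f u u' ≤ Jf a b lam θ f w w'

/-- `u` is a local maximizer of `J` restricted to `C_{1,0}[a,b]`,
w.r.t. the norm `‖u‖ = ‖u‖_∞ + ‖u'‖_∞` on `C¹[a,b]`. -/
noncomputable def JlocMax (a b lam : ℝ) (θ f : ℝ → ℝ) (u u' : ℝ → ℝ) : Prop :=
  C10 a b u u' ∧ ∃ r > 0, ∀ w w' : ℝ → ℝ, C10 a b w w' →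
    supN a b (w - u) + supN a b (w' - u') < r →
    Jf a b lam θ f w w' ≤ Jf a b lam θ f u u'

/-- The primitive of a continuous function on `[a,b]`. -/
theorem aux_prim (a b : ℝ) (hab : a < b) (v : ℝ → ℝ) (hv : C0 a b v) (u₀ : ℝ) :
    C10 a b (fun x => u₀ + ∫ ξ in a..x, v ξ) v := by
  refine ⟨⟨fun x hx => ?_, hv.1⟩, hv.2⟩
  haveI : Fact (x ∈ Icc a b) := ⟨hx⟩
  refine HasDerivWithinAt.const_add u₀ ?_
  refine integral_hasDerivWithinAt_right (t := Icc a b) ?_ ?_ (hv.1 x hx)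
  · refine (hv.1.mono ?_).intervalIntegrable
    rw [uIcc_of_le hx.1]
    exact Icc_subset_Icc_right hx.2
  · exact hv.1.stronglyMeasurableAtFilter_nhdsWithin measurableSet_Icc x

theorem aux_nonneg (a b : ℝ) (h : ℝ → ℝ) : 0 ≤ supN a b h := by
  apply Real.sSup_nonneg
  rintro _ ⟨x, -, rfl⟩
  exact abs_nonneg _

theorem aux_le (a b : ℝ) (h : ℝ → ℝ) (hh : ContinuousOn h (Icc a b)) (x : ℝ)
    (hx : x ∈ Icc a b) : |h x| ≤ supN a b h :=
  le_csSup (isCompact_Icc.image_of_continuousOn hh.abs).bddAbove ⟨x, hx, rfl⟩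

/-- `J(u) = K(u')`, by integration by parts. -/
theorem aux_JK (a b lam : ℝ) (hab : a < b)
    (θ : ℝ → ℝ) (hθc : ContinuousOn θ (Icc a b))
    (f : ℝ → ℝ) (hf : ContinuousOn f (Icc a b))
    (F : ℝ → ℝ) (hF : ContinuousOn F (Icc a b)) (hFa : F a = 0) (hFb : F b = 0)
    (hθF : ∀ x ∈ Icc a b,
      HasDerivWithinAt (fun t => θ t * F t) (-(θ x * f x)) (Icc a b) x)
    (u u' : ℝ → ℝ) (hu : IsC1 a b u u') :
    Jf a b lam θ f u u' = Kf a b lam θ F u' := by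
  have hI : uIcc a b = Icc a b := uIcc_of_le hab.le
  have huc : ContinuousOn u (Icc a b) := fun x hx => (hu.1 x hx).continuousWithinAt
  have hu'c := hu.2
  have ii : ∀ g : ℝ → ℝ, ContinuousOn g (Icc a b) → IntervalIntegrable g volume a b := by
    intro g hg
    rw [← hI] at hg
    exact hg.intervalIntegrable
  have key := integral_mul_deriv_eq_deriv_mul_of_hasDerivWithinAt
    (a := a) (b := b) (u := fun t => θ t * F t) (u' := fun x => -(θ x * f x)) (v := u) (v' := u')
    (by rw [hI]; exact hθF) (by rw [hI]; exact hu.1)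
    (ii _ (by fun_prop)) (ii _ hu'c)
  simp only [hFa, hFb, mul_zero, zero_mul, sub_zero, zero_sub] at key
  have h1 : Jf a b lam θ f u u' = (∫ x in a..b, θ x * ((1/2) * ((1/2) * u' x ^ 2 - lam) ^ 2))
      + ∫ x in a..b, -(θ x * f x) * u x := by
    rw [← integral_add (ii _ (by fun_prop)) (ii _ (by fun_prop))]
    unfold Jf
    congr 1
    ext x
    ring
  have h2 : Kf a b lam θ F u' = (∫ x in a..b, θ x * ((1/2) * ((1/2) * u' x ^ 2 - lam) ^ 2))
      - ∫ x in a..b, θ x * F x * u' x := by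
    rw [← integral_sub (ii _ (by fun_prop)) (ii _ (by fun_prop))]
    unfold Kf
    congr 1
    ext x
    ring
  rw [h1, h2, key]
  ring

/-- Lifting a nearby derivative to a nearby function. -/
theorem aux_lift (a b : ℝ) (hab : a < b) (u u' : ℝ → ℝ) (hu : C10 a b u u')
    (w : ℝ → ℝ) (hw : C0 a b w) (r : ℝ)
    (h : supN a b (w - u') < r / (1 + (b - a))) :
    supN a b ((fun x => u a + ∫ ξ in a..x, w ξ) - u) + supN a b (w - u') < r := by
  have hW := aux_prim a b hab w hw (u a)
  have hba : 0 < 1 + (b - a) := by linarith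
  rw [lt_div_iff₀ hba] at h
  have hb := aux_le a b (w - u') (hw.1.sub hu.1.2)
  have h0 := aux_nonneg a b (w - u')
  have hs : supN a b ((fun x => u a + ∫ ξ in a..x, w ξ) - u)
      ≤ supN a b (w - u') * (b - a) := by
    apply csSup_le
    · exact ⟨_, a, ⟨le_rfl, hab.le⟩, rfl⟩
    rintro _ ⟨x, hx, rfl⟩
    have := (convex_Icc a b).norm_image_sub_le_of_norm_hasDerivWithin_le
      (f := (fun x => u a + ∫ ξ in a..x, w ξ) - u) (f' := w - u')
      (fun y hy => (hW.1.1 y hy).sub (hu.1.1 y hy)) hb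
      (show a ∈ Icc a b from ⟨le_rfl, hab.le⟩) hx
    simp only [Pi.sub_apply, integral_same, add_zero, sub_self, sub_zero, Real.norm_eq_abs] at this
    rw [abs_of_nonneg (sub_nonneg.2 hx.1)] at this
    refine this.trans ?_
    exact mul_le_mul_of_nonneg_left (by linarith [hx.2]) h0
  linarith

theorem stmt11 (a b lam : ℝ) (hab : a < b) (hlam : 0 < lam)
    (θ : ℝ → ℝ) (hθc : ContinuousOn θ (Set.Icc a b)) (hθ : ∀ x ∈ Set.Icc a b, 0 < θ x)
    (f : ℝ → ℝ) (hf : ContinuousOn f (Set.Icc a b))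
    (F : ℝ → ℝ) (hF : ContDiffOn ℝ 1 F (Set.Icc a b)) (hFa : F a = 0) (hFb : F b = 0)
    (hFne : ∀ x ∈ Set.Ioo a b, F x ≠ 0)
    (hFsmall : supN a b F < (2 * lam / 3) ^ ((3 : ℝ) / 2))
    (hθF : ∀ x ∈ Set.Icc a b,
      HasDerivWithinAt (fun t => θ t * F t) (-(θ x * f x)) (Set.Icc a b) x) :
    (∀ u u' : ℝ → ℝ, JlocMin a b lam θ f u u' → KlocMin a b lam θ F u') ∧
    (∀ u u' : ℝ → ℝ, JlocMax a b lam θ f u u' → KlocMax a b lam θ F u') ∧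
    (∀ v : ℝ → ℝ, KlocMin a b lam θ F v → ∀ u₀ : ℝ,
      C10 a b (fun x => u₀ + ∫ ξ in a..x, v ξ) v ∧
      JlocMin a b lam θ f (fun x => u₀ + ∫ ξ in a..x, v ξ) v) ∧
    (∀ v : ℝ → ℝ, KlocMax a b lam θ F v → ∀ u₀ : ℝ,
      C10 a b (fun x => u₀ + ∫ ξ in a..x, v ξ) v ∧
      JlocMax a b lam θ f (fun x => u₀ + ∫ ξ in a..x, v ξ) v) := by
  have JK := fun u u' (h : C10 a b u u') =>
    aux_JK a b lam hab θ hθc f hf F hF.continuousOn hFa hFb hθF u u' h.1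
  have hba : 0 < 1 + (b - a) := by linarith
  refine ⟨?_, ?_, ?_, ?_⟩
  · rintro u u' ⟨hu, r, hr, H⟩
    refine ⟨⟨hu.1.2, hu.2⟩, r / (1 + (b - a)), div_pos hr hba, fun w hw hd => ?_⟩
    have hW := aux_prim a b hab w hw (u a)
    have := H _ w hW (aux_lift a b hab u u' hu w hw r hd)
    rwa [JK _ _ hu, JK _ _ hW] at this
  · rintro u u' ⟨hu, r, hr, H⟩
    refine ⟨⟨hu.1.2, hu.2⟩, r / (1 + (b - a)), div_pos hr hba, fun w hw hd => ?_⟩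
    have hW := aux_prim a b hab w hw (u a)
    have := H _ w hW (aux_lift a b hab u u' hu w hw r hd)
    rwa [JK _ _ hu, JK _ _ hW] at this
  · rintro v ⟨hv, r, hr, H⟩ u₀
    have hV := aux_prim a b hab v hv u₀
    refine ⟨hV, hV, r, hr, fun w w' hw hd => ?_⟩
    rw [JK _ _ hV, JK _ _ hw]
    refine H w' ⟨hw.1.2, hw.2⟩ (lt_of_le_of_lt ?_ hd)
    exact le_add_of_nonneg_left (aux_nonneg _ _ _)
  · rintro v ⟨hv, r, hr, H⟩ u₀
    have hV := aux_prim a b hab v hv u₀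
    refine ⟨hV, hV, r, hr, fun w w' hw hd => ?_⟩
    rw [JK _ _ hV, JK _ _ hw]
    refine H w' ⟨hw.1.2, hw.2⟩ (lt_of_le_of_lt ?_ hd)
    exact le_add_of_nonneg_left (aux_nonneg _ _ _)
end

section
/- The functional K has no local minimizers on C₀[a,b] with respect to the norm ‖·‖_∞. Consequently, if x ↦ θ(x)F(x) is differentiable on [a,b] with derivative −θf, then the functional J restricted to C_{1,0}[a,b] has no local minimizers with respect to the norm ‖u‖ = ‖u‖_∞ + ‖u'‖_∞. -/
open Set MeasureTheory intervalIntegral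

theorem supN_le_aux (a b r : ℝ) (hab : a < b) (h : ℝ → ℝ) (hr : ∀ x ∈ Set.Icc a b, |h x| ≤ r) :
    supN a b h ≤ r := by
  unfold supN
  apply csSup_le
  · exact ⟨_, a, ⟨le_refl a, hab.le⟩, rfl⟩
  · rintro _ ⟨x, hx, rfl⟩
    exact hr x hx

theorem core_aux (a b lam : ℝ) (hab : a < b) (hlam : 0 < lam)
    (θ : ℝ → ℝ) (hθc : ContinuousOn θ (Set.Icc a b)) (hθ : ∀ x ∈ Set.Icc a b, 0 < θ x)
    (w : ℝ → ℝ) (hw : ContinuousOn w (Set.Icc a b)) (hwa : w a = 0) (r : ℝ) (hr : 0 < r) :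
    ∃ h : ℝ → ℝ, Continuous h ∧ h a = 0 ∧ h b = 0 ∧ (∀ x ∈ Set.Icc a b, |h x| ≤ r) ∧
      ∀ k p q : ℝ → ℝ, ContinuousOn k (Set.Icc a b) → ContinuousOn p (Set.Icc a b) →
        ContinuousOn q (Set.Icc a b) →
        Jf a b lam θ k (p + q) (w + h) + Jf a b lam θ k (p - q) (w - h)
          < 2 * Jf a b lam θ k p w := by
  obtain ⟨c, hac, hcb, hc⟩ : ∃ c, a < c ∧ c ≤ b ∧ ∀ x ∈ Set.Icc a c, w x ^ 2 ≤ lam / 3 := by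
    have h1 : ContinuousWithinAt (fun x => w x ^ 2) (Set.Icc a b) a :=
      (hw.pow 2) a ⟨le_refl a, hab.le⟩
    have h2 : ∀ᶠ x in nhdsWithin a (Set.Icc a b), w x ^ 2 < lam / 3 := by
      apply h1.eventually_lt_const
      simp only [hwa]; norm_num; exact hlam
    rw [eventually_nhdsWithin_iff, Metric.eventually_nhds_iff] at h2
    obtain ⟨e, he, h2⟩ := h2
    refine ⟨min b (a + e / 2), lt_min hab (by linarith), min_le_left _ _, ?_⟩
    intro x hx
    have hx1 := le_trans hx.2 (min_le_left _ _)
    have hx2 := le_trans hx.2 (min_le_right _ _)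
    apply le_of_lt
    apply h2 _ ⟨hx.1, hx1⟩
    rw [Real.dist_eq, abs_of_nonneg (by linarith [hx.1])]
    linarith
  set m : ℝ := min r (Real.sqrt lam) with hm
  have hm0 : 0 < m := lt_min hr (Real.sqrt_pos.2 hlam)
  have hml : m ^ 2 ≤ lam := by
    have := min_le_right r (Real.sqrt lam)
    calc m ^ 2 ≤ Real.sqrt lam ^ 2 := by gcongr
      _ = lam := Real.sq_sqrt hlam.le
  set s : ℝ := m / (b - a) ^ 2 with hs
  have hba : 0 < b - a := by linarith
  have hs0 : 0 < s := by positivity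
  set h : ℝ → ℝ := fun x => s * max 0 ((x - a) * (c - x)) with hh
  have hcont : Continuous h := by fun_prop
  have hnn : ∀ x, 0 ≤ h x := fun x => mul_nonneg hs0.le (le_max_left _ _)
  have hle : ∀ x ∈ Set.Icc a b, h x ≤ m := by
    intro x hx
    have : max 0 ((x - a) * (c - x)) ≤ (b - a) ^ 2 := by
      apply max_le (by positivity)
      have h1 := hx.1
      have h2 := hx.2
      nlinarith [mul_nonneg (sub_nonneg.2 h1) (sub_nonneg.2 h2), mul_nonneg (sub_nonneg.2 h1) (sub_nonneg.2 hcb), mul_nonneg (sub_nonneg.2 h1) (sub_nonneg.2 h1), mul_nonneg (sub_nonneg.2 h2) (sub_nonneg.2 h2)]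
    calc h x ≤ s * (b - a) ^ 2 := by simp only [hh]; gcongr
      _ = m := by rw [hs]; field_simp
  have hzero : ∀ x, c ≤ x → h x = 0 := by
    intro x hx
    have : (x - a) * (c - x) ≤ 0 := mul_nonpos_of_nonneg_of_nonpos (by linarith) (by linarith)
    simp [hh, max_eq_left this]
  refine ⟨h, hcont, by simp [hh], hzero b hcb, ?_, ?_⟩
  · intro x hx
    rw [abs_of_nonneg (hnn x)]
    exact (hle x hx).trans (min_le_left _ _)
  intro k p q hk hp hq
  have hhc : ContinuousOn h (Set.Icc a b) := hcont.continuousOn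
  have hu : Set.uIcc a b = Set.Icc a b := Set.uIcc_of_le hab.le
  have key : 0 < ∫ x in a..b, θ x * (h x ^ 2 * (lam - 3 / 2 * w x ^ 2 - h x ^ 2 / 4)) := by
    have hpt : ∀ x ∈ Set.Icc a c, 0 < lam - 3 / 2 * w x ^ 2 - h x ^ 2 / 4 := by
      intro x hx
      have h1 := hc x hx
      have h2 : h x ^ 2 ≤ lam := by
        have := hle x ⟨hx.1, hx.2.trans hcb⟩
        have h3 := hnn x
        calc h x ^ 2 ≤ m ^ 2 := by gcongr
          _ ≤ lam := hml
      linarith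
    apply intervalIntegral.integral_pos hab
    · fun_prop
    · intro x hx
      have hx' : x ∈ Set.Icc a b := ⟨hx.1.le, hx.2⟩
      by_cases hxc : x ≤ c
      · have := hpt x ⟨hx'.1, hxc⟩
        have := hθ x hx'
        positivity
      · rw [hzero x (by linarith)]; simp
    · refine ⟨(a + c) / 2, ⟨by linarith, by linarith⟩, ?_⟩
      have h1 := hpt ((a + c) / 2) ⟨by linarith, by linarith⟩
      have h2 := hθ ((a + c) / 2) ⟨by linarith, by linarith⟩
      have h3 : 0 < h ((a + c) / 2) := by
        apply mul_pos hs0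
        apply lt_max_of_lt_right
        apply mul_pos <;> linarith
      positivity
  have e : 2 * Jf a b lam θ k p w - (Jf a b lam θ k (p + q) (w + h) + Jf a b lam θ k (p - q) (w - h))
      = ∫ x in a..b, θ x * (h x ^ 2 * (lam - 3 / 2 * w x ^ 2 - h x ^ 2 / 4)) := by
    unfold Jf
    simp only [Pi.add_apply, Pi.sub_apply]
    rw [← intervalIntegral.integral_const_mul, ← intervalIntegral.integral_add,
      ← intervalIntegral.integral_sub]
    · congr 1
      ext x
      ring
    all_goals
      apply ContinuousOn.intervalIntegrable
      rw [hu]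
      fun_prop
  linarith

theorem stmt13 (a b lam : ℝ) (hab : a < b) (hlam : 0 < lam)
    (θ : ℝ → ℝ) (hθc : ContinuousOn θ (Set.Icc a b)) (hθ : ∀ x ∈ Set.Icc a b, 0 < θ x)
    (f : ℝ → ℝ) (hf : ContinuousOn f (Set.Icc a b))
    (F : ℝ → ℝ) (hF : ContDiffOn ℝ 1 F (Set.Icc a b)) (hFa : F a = 0) (hFb : F b = 0)
    (hFne : ∀ x ∈ Set.Ioo a b, F x ≠ 0)
    (hFsmall : supN a b F < (2 * lam / 3) ^ ((3 : ℝ) / 2)) :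
    (∀ v : ℝ → ℝ, ¬ KlocMin a b lam θ F v) ∧
    ((∀ x ∈ Set.Icc a b,
        HasDerivWithinAt (fun t => θ t * F t) (-(θ x * f x)) (Set.Icc a b) x) →
      ∀ u u' : ℝ → ℝ, ¬ JlocMin a b lam θ f u u') := by
  constructor
  · rintro v ⟨⟨hvc, hva, hvb⟩, r, hr, hmin⟩
    obtain ⟨h, hc, ha, hb, hb1, hJ⟩ := core_aux a b lam hab hlam θ hθc hθ v hvc hva (r / 2) (by linarith)
    have hJ' := hJ F v h hF.continuousOn hvc hc.continuousOn
    have h1 := hmin (v + h) ⟨hvc.add hc.continuousOn, by simp [hva, ha], by simp [hvb, hb]⟩ (by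
      apply lt_of_le_of_lt (supN_le_aux a b (r / 2) hab _ _) (by linarith)
      intro x hx
      simpa using hb1 x hx)
    have h2 := hmin (v - h) ⟨hvc.sub hc.continuousOn, by simp [hva, ha], by simp [hvb, hb]⟩ (by
      apply lt_of_le_of_lt (supN_le_aux a b (r / 2) hab _ _) (by linarith)
      intro x hx
      simpa using hb1 x hx)
    change Jf a b lam θ F v v ≤ Jf a b lam θ F (v + h) (v + h) at h1
    change Jf a b lam θ F v v ≤ Jf a b lam θ F (v - h) (v - h) at h2
    linarith
  · rintro - u u' ⟨⟨⟨hud, huc⟩, hua, hub⟩, r, hr, hmin⟩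
    have hba : 0 < b - a := by linarith
    set d : ℝ := r / (2 * (1 + (b - a))) with hd
    have hd0 : 0 < d := by positivity
    have hdr : d * (b - a) + d < r := by
      have : d * (b - a) + d = r / 2 := by rw [hd]; field_simp; ring
      linarith
    obtain ⟨h, hc, ha, hb, hb1, hJ⟩ := core_aux a b lam hab hlam θ hθc hθ u' huc hua d hd0
    set q : ℝ → ℝ := fun x => ∫ t in a..x, h t with hq
    have hqd : ∀ x, HasDerivAt q (h x) x := fun x => hc.integral_hasStrictDerivAt a x |>.hasDerivAt
    have hqc : Continuous q := continuous_iff_continuousAt.2 fun x => (hqd x).continuousAt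
    have hqb : ∀ x ∈ Set.Icc a b, |q x| ≤ d * (b - a) := by
      intro x hx
      have := intervalIntegral.norm_integral_le_of_norm_le_const (f := h) (a := a) (b := x) (C := d) (by
        intro t ht
        rw [Set.uIoc_of_le hx.1] at ht
        exact hb1 t ⟨ht.1.le, ht.2.trans hx.2⟩)
      rw [Real.norm_eq_abs, abs_of_nonneg (sub_nonneg.2 hx.1)] at this
      refine this.trans ?_
      have := hx.2
      gcongr
    have huc0 : ContinuousOn u (Set.Icc a b) := fun x hx => (hud x hx).continuousWithinAt
    have hJ' := hJ f u q hf huc0 hqc.continuousOn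
    have h1 := hmin (u + q) (u' + h)
      ⟨⟨fun x hx => (hud x hx).add (hqd x).hasDerivWithinAt, huc.add hc.continuousOn⟩,
        by simp [hua, ha], by simp [hub, hb]⟩ (by
      refine lt_of_le_of_lt (add_le_add (supN_le_aux a b (d * (b - a)) hab _ ?_) (supN_le_aux a b d hab _ ?_)) hdr
      · intro x hx
        simpa using hqb x hx
      · intro x hx
        simpa using hb1 x hx)
    have h2 := hmin (u - q) (u' - h)
      ⟨⟨fun x hx => (hud x hx).sub (hqd x).hasDerivWithinAt, huc.sub hc.continuousOn⟩,
        by simp [hua, ha], by simp [hub, hb]⟩ (by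
      refine lt_of_le_of_lt (add_le_add (supN_le_aux a b (d * (b - a)) hab _ ?_) (supN_le_aux a b d hab _ ?_)) hdr
      · intro x hx
        simpa using hqb x hx
      · intro x hx
        simpa using hb1 x hx)
    linarith
end

section
/- Let A ∈ (0, (2λ/3)^{3/2}) and let y₃ < y₂ < y₁ be the three real solutions of 2y²(y + λ) = A² (so y₃ ∈ (−λ, −2λ/3), y₂ ∈ (−2λ/3, 0), y₁ ∈ (0, λ/3)), and let z₁ < z₂ < z₃ be the three real solutions of z((1/2)z² − λ) = A (so z₁ ∈ (−2κ, −κ), z₂ ∈ (−κ, κ), z₃ ∈ (κ, 2κ), where κ = √(2λ/3)). Then z₁ = A/y₂, z₂ = A/y₃, and z₃ = A/y₁. -/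
open Set

/-- If `y` solves the `E`-equation then `A / y` solves the `G`-equation. -/
lemma root_of_y (lam A y : ℝ) (hy0 : y ≠ 0) (h : 2 * y ^ 2 * (y + lam) = A ^ 2) :
    (A / y) * ((1/2) * (A / y) ^ 2 - lam) = A := by
  have h1 : (A / y) ^ 2 = 2 * (y + lam) := by
    rw [div_pow, ← h]; field_simp
  rw [h1]; field_simp; ring

/-- Any root of the cubic is one of three given distinct roots. -/
lemma root_mem (lam A a b c w : ℝ) (hab : a < b) (hbc : b < c)
    (ha : a * ((1/2) * a ^ 2 - lam) = A) (hb : b * ((1/2) * b ^ 2 - lam) = A)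
    (hc : c * ((1/2) * c ^ 2 - lam) = A) (hw : w * ((1/2) * w ^ 2 - lam) = A) :
    w = a ∨ w = b ∨ w = c := by
  have e1 : a ^ 2 + a * b + b ^ 2 = 2 * lam :=
    mul_left_cancel₀ (sub_ne_zero.2 hab.ne) (by linear_combination 2 * ha - 2 * hb)
  have e2 : b ^ 2 + b * c + c ^ 2 = 2 * lam :=
    mul_left_cancel₀ (sub_ne_zero.2 hbc.ne) (by linear_combination 2 * hb - 2 * hc)
  have e3 : a + b + c = 0 :=
    mul_left_cancel₀ (sub_ne_zero.2 (hab.trans hbc).ne) (by linear_combination e1 - e2)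
  have hc' : c = -a - b := by linarith
  have key : (w - a) * ((w - b) * (w - c)) = 0 := by
    subst hc'
    linear_combination 2 * hw - 2 * ha + (a - w) * e1
  rcases mul_eq_zero.1 key with h | h
  · left; linarith
  · rcases mul_eq_zero.1 h with h | h
    · right; left; linarith
    · right; right; linarith

theorem stmt17 (lam : ℝ) (hlam : 0 < lam) (κ : ℝ) (hκ : κ = Real.sqrt (2 * lam / 3))
    (A : ℝ) (hA : A ∈ Set.Ioo 0 ((2 * lam / 3) ^ ((3 : ℝ) / 2)))
    (y₁ y₂ y₃ : ℝ) (hy : y₃ < y₂ ∧ y₂ < y₁)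
    (hy₃ : y₃ ∈ Set.Ioo (-lam) (-(2 * lam / 3)) ∧ 2 * y₃ ^ 2 * (y₃ + lam) = A ^ 2)
    (hy₂ : y₂ ∈ Set.Ioo (-(2 * lam / 3)) 0 ∧ 2 * y₂ ^ 2 * (y₂ + lam) = A ^ 2)
    (hy₁ : y₁ ∈ Set.Ioo 0 (lam / 3) ∧ 2 * y₁ ^ 2 * (y₁ + lam) = A ^ 2)
    (z₁ z₂ z₃ : ℝ) (hz : z₁ < z₂ ∧ z₂ < z₃)
    (hz₁ : z₁ ∈ Set.Ioo (-(2 * κ)) (-κ) ∧ z₁ * ((1/2) * z₁ ^ 2 - lam) = A)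
    (hz₂ : z₂ ∈ Set.Ioo (-κ) κ ∧ z₂ * ((1/2) * z₂ ^ 2 - lam) = A)
    (hz₃ : z₃ ∈ Set.Ioo κ (2 * κ) ∧ z₃ * ((1/2) * z₃ ^ 2 - lam) = A) :
    z₁ = A / y₂ ∧ z₂ = A / y₃ ∧ z₃ = A / y₁ := by
  obtain ⟨⟨_, h3⟩, e3⟩ := hy₃
  obtain ⟨⟨_, h2⟩, e2⟩ := hy₂
  obtain ⟨⟨h1, _⟩, e1⟩ := hy₁
  have hA0 : 0 < A := hA.1
  have h3' : y₃ < 0 := by linarith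
  have o1 : A / y₂ < A / y₃ := by
    rw [div_eq_mul_inv, div_eq_mul_inv]
    exact mul_lt_mul_of_pos_left ((inv_lt_inv_of_neg h2 h3').2 hy.1) hA0
  have o2 : A / y₃ < A / y₁ :=
    (div_neg_of_pos_of_neg hA0 h3').trans (div_pos hA0 h1)
  have m := fun w hw => root_mem lam A z₁ z₂ z₃ w hz.1 hz.2 hz₁.2 hz₂.2 hz₃.2 hw
  obtain ⟨hz12, hz23⟩ := hz
  rcases m _ (root_of_y lam A y₂ h2.ne e2) with a | a | a <;>
  rcases m _ (root_of_y lam A y₃ h3'.ne e3) with b | b | b <;>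
  rcases m _ (root_of_y lam A y₁ h1.ne' e1) with c | c | c <;>
  first
  | exact ⟨a.symm, b.symm, c.symm⟩
  | (exfalso; linarith)
end

section
/- Let 0 < R₂ < R₁, let n ≥ 1 be an integer, and let f : [R₂,R₁] → ℝ be continuous with ∫_{R₂}^{R₁} ρ^{n−1} f(ρ) dρ = 0 and such that there exists R₃ ∈ (R₂,R₁) with f(ρ) = 0 if and only if ρ = R₃. Define F(r) := −r^{1−n} ∫_{R₂}^{r} ρ^{n−1} f(ρ) dρ for r ∈ [R₂,R₁]. Then F(R₁) = F(R₂) = 0; either F(r) > 0 for all r ∈ (R₂,R₁) or F(r) < 0 for all r ∈ (R₂,R₁); and R₂^{n−1} |F(r)| ≤ ∫_{R₂}^{R₁} ρ^{n−1} |f(ρ)| dρ for every r ∈ [R₂,R₁]. In particular, if ∫_{R₂}^{R₁} ρ^{n−1}|f(ρ)| dρ < R₂^{n−1}(2λ/3)^{3/2} for some λ > 0, then |F(r)| < (2λ/3)^{3/2} for all r ∈ [R₂,R₁]. -/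
open Set MeasureTheory intervalIntegral

theorem sign_aux (a b : ℝ) (g : ℝ → ℝ) (hg : ContinuousOn g (Set.Ioo a b))
    (h0 : ∀ x ∈ Set.Ioo a b, g x ≠ 0) :
    (∀ x ∈ Set.Ioo a b, 0 < g x) ∨ (∀ x ∈ Set.Ioo a b, g x < 0) := by
  by_contra! h
  obtain ⟨⟨x, hx, hx0⟩, ⟨y, hy, hy0⟩⟩ := h
  obtain ⟨z, hz, hz0⟩ := isPreconnected_Ioo.intermediate_value hx hy hg ⟨hx0, hy0⟩
  exact h0 z hz hz0

theorem core_aux_s18 (a b c : ℝ) (hc : c ∈ Set.Ioo a b) (g : ℝ → ℝ)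
    (hi : ∀ x ∈ Set.Icc a b, ∀ y ∈ Set.Icc a b, IntervalIntegrable g volume x y)
    (h1 : ∀ x ∈ Set.Ioo a c, 0 < g x) (h2 : ∀ x ∈ Set.Ioo c b, g x < 0)
    (hb : ∫ x in a..b, g x = 0) (r : ℝ) (hr : r ∈ Set.Ioo a b) :
    0 < ∫ x in a..r, g x := by
  have ha' : a ∈ Set.Icc a b := ⟨le_rfl, (hr.1.trans hr.2).le⟩
  have hb' : b ∈ Set.Icc a b := ⟨(hr.1.trans hr.2).le, le_rfl⟩
  have hr' : r ∈ Set.Icc a b := ⟨hr.1.le, hr.2.le⟩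
  rcases le_or_gt r c with h | h
  · exact intervalIntegral_pos_of_pos_on (hi a ha' r hr')
      (fun x hx => h1 x ⟨hx.1, hx.2.trans_le h⟩) hr.1
  · have hs := integral_add_adjacent_intervals (hi a ha' r hr') (hi r hr' b hb')
    have hp : 0 < ∫ x in r..b, -g x := intervalIntegral_pos_of_pos_on (hi r hr' b hb').neg
      (fun x hx => neg_pos.2 (h2 x ⟨h.trans hx.1, hx.2⟩)) hr.2
    rw [intervalIntegral.integral_neg] at hp
    linarith

theorem stmt18 (R₁ R₂ : ℝ) (hR₂ : 0 < R₂) (hRR : R₂ < R₁) (n : ℕ) (hn : 1 ≤ n)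
    (f : ℝ → ℝ) (hf : ContinuousOn f (Set.Icc R₂ R₁))
    (hbal : ∫ ρ in R₂..R₁, ρ ^ (n - 1) * f ρ = 0)
    (hzero : ∃ R₃ ∈ Set.Ioo R₂ R₁, ∀ ρ ∈ Set.Icc R₂ R₁, f ρ = 0 ↔ ρ = R₃)
    (F : ℝ → ℝ)
    (hF : ∀ r ∈ Set.Icc R₂ R₁, F r = -(1 / r ^ (n - 1)) * ∫ ρ in R₂..r, ρ ^ (n - 1) * f ρ) :
    F R₁ = 0 ∧ F R₂ = 0 ∧
    ((∀ r ∈ Set.Ioo R₂ R₁, 0 < F r) ∨ (∀ r ∈ Set.Ioo R₂ R₁, F r < 0)) ∧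
    (∀ r ∈ Set.Icc R₂ R₁, R₂ ^ (n - 1) * |F r| ≤ ∫ ρ in R₂..R₁, ρ ^ (n - 1) * |f ρ|) ∧
    ∀ lam : ℝ, 0 < lam →
      (∫ ρ in R₂..R₁, ρ ^ (n - 1) * |f ρ|) < R₂ ^ (n - 1) * (2 * lam / 3) ^ ((3 : ℝ) / 2) →
      ∀ r ∈ Set.Icc R₂ R₁, |F r| < (2 * lam / 3) ^ ((3 : ℝ) / 2) := by
  obtain ⟨c, hc, hz⟩ := hzero
  have ha' : R₂ ∈ Set.Icc R₂ R₁ := ⟨le_rfl, hRR.le⟩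
  have hb' : R₁ ∈ Set.Icc R₂ R₁ := ⟨hRR.le, le_rfl⟩
  set g : ℝ → ℝ := fun ρ => ρ ^ (n - 1) * f ρ with hgdef
  have hg : ContinuousOn g (Set.Icc R₂ R₁) := by
    apply ContinuousOn.mul _ hf
    fun_prop
  have hi : ∀ x ∈ Set.Icc R₂ R₁, ∀ y ∈ Set.Icc R₂ R₁, IntervalIntegrable g volume x y :=
    fun x hx y hy => (hg.mono (Set.uIcc_subset_Icc hx hy)).intervalIntegrable
  have hne : ∀ x ∈ Set.Icc R₂ R₁, x ≠ c → g x ≠ 0 := fun x hx hxc =>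
    mul_ne_zero (pow_pos (hR₂.trans_le hx.1) _).ne' (fun h => hxc ((hz x hx).1 h))
  have hpow : ∀ r ∈ Set.Icc R₂ R₁, 0 < 1 / r ^ (n - 1) := fun r hr =>
    one_div_pos.2 (pow_pos (hR₂.trans_le hr.1) _)
  have hbd : ∀ r ∈ Set.Icc R₂ R₁,
      R₂ ^ (n - 1) * |F r| ≤ ∫ ρ in R₂..R₁, ρ ^ (n - 1) * |f ρ| := by
    intro r hr
    have hrp : 0 < r ^ (n - 1) := pow_pos (hR₂.trans_le hr.1) _
    have e : ∫ ρ in R₂..R₁, ρ ^ (n - 1) * |f ρ| = ∫ ρ in R₂..R₁, |g ρ| := by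
      apply intervalIntegral.integral_congr
      intro x hx
      rw [Set.uIcc_of_le hRR.le] at hx
      simp only [hgdef, abs_mul]
      rw [abs_of_pos (pow_pos (hR₂.trans_le hx.1) _)]
    have h1 : |∫ ρ in R₂..r, g ρ| ≤ ∫ ρ in R₂..r, |g ρ| :=
      abs_integral_le_integral_abs hr.1
    have h2 : ∫ ρ in R₂..r, |g ρ| ≤ ∫ ρ in R₂..R₁, |g ρ| := by
      have hs := integral_add_adjacent_intervals (hi _ ha' r hr).abs (hi r hr _ hb').abs
      have : 0 ≤ ∫ ρ in r..R₁, |g ρ| :=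
        intervalIntegral.integral_nonneg hr.2 (fun _ _ => abs_nonneg _)
      linarith
    rw [e, hF r hr, abs_mul, abs_neg, abs_of_pos (hpow r hr), ← mul_assoc, mul_one_div]
    have h3 : R₂ ^ (n - 1) / r ^ (n - 1) ≤ 1 :=
      (div_le_one hrp).2 (pow_le_pow_left₀ hR₂.le hr.1 _)
    exact (mul_le_of_le_one_left (abs_nonneg _) h3).trans (h1.trans h2)
  refine ⟨by rw [hF _ hb', hbal, mul_zero], by rw [hF _ ha', integral_same, mul_zero], ?_, hbd, ?_⟩
  · have s1 := sign_aux R₂ c g (hg.mono fun x hx => ⟨hx.1.le, (hx.2.trans hc.2).le⟩)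
      (fun x hx => hne x ⟨hx.1.le, (hx.2.trans hc.2).le⟩ hx.2.ne)
    have s2 := sign_aux c R₁ g (hg.mono fun x hx => ⟨(hc.1.trans hx.1).le, hx.2.le⟩)
      (fun x hx => hne x ⟨(hc.1.trans hx.1).le, hx.2.le⟩ hx.1.ne')
    have hc' : c ∈ Set.Icc R₂ R₁ := ⟨hc.1.le, hc.2.le⟩
    have hs := integral_add_adjacent_intervals (hi _ ha' c hc') (hi c hc' _ hb')
    have hbn : ∫ x in R₂..R₁, -g x = 0 := by
      rw [intervalIntegral.integral_neg, hbal, neg_zero]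
    rcases s1 with s1 | s1 <;> rcases s2 with s2 | s2
    · have p1 := intervalIntegral_pos_of_pos_on (hi _ ha' c hc') s1 hc.1
      have p2 := intervalIntegral_pos_of_pos_on (hi c hc' _ hb') s2 hc.2
      linarith
    · right
      intro r hr
      have hr' : r ∈ Set.Icc R₂ R₁ := ⟨hr.1.le, hr.2.le⟩
      rw [hF r hr', neg_mul]
      exact neg_neg_of_pos (mul_pos (hpow r hr') (core_aux_s18 R₂ R₁ c hc g hi s1 s2 hbal r hr))
    · left
      intro r hr
      have hr' : r ∈ Set.Icc R₂ R₁ := ⟨hr.1.le, hr.2.le⟩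
      have k := core_aux_s18 R₂ R₁ c hc (fun x => -g x) (fun x hx y hy => (hi x hx y hy).neg)
        (fun x hx => neg_pos.2 (s1 x hx)) (fun x hx => neg_neg_of_pos (s2 x hx)) hbn r hr
      rw [intervalIntegral.integral_neg] at k
      rw [hF r hr', neg_mul, ← mul_neg]
      exact mul_pos (hpow r hr') k
    · have p1 := intervalIntegral_pos_of_pos_on (hi _ ha' c hc').neg
        (fun x hx => neg_pos.2 (s1 x hx)) hc.1
      have p2 := intervalIntegral_pos_of_pos_on (hi c hc' _ hb').neg
        (fun x hx => neg_pos.2 (s2 x hx)) hc.2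
      simp only [Pi.neg_apply, intervalIntegral.integral_neg] at p1 p2
      linarith
  · intro lam _ hlt r hr
    exact lt_of_mul_lt_mul_left ((hbd r hr).trans_lt hlt) (pow_pos hR₂ _).le
end
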